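/- Assume ρ̂ = ρ + αλ_min − ζ̃_{L*−K} > 0, D_K is not the zero map, and ω_n = ω₀·η̄ⁿ for some ω₀ ≥ 0 and η̄ ∈ [0,1), with ‖K_n − K‖ ≤ ω_n for all n. Let γ ∈ Γ, let z₀ ∈ H, and define for every n ∈ ℕ: x_n = J_{γC}(z_n), w_n = D_{K_n} x_n, y_n = J_{γA}(2x_n − z_n − γw_n), z_{n+1} = z_n + y_n − x_n − γ(D_{K_n} y_n − w_n). Then (z_n) converges linearly to the point z̄ ∈ H with V^γ z̄ = z̄, and (x_n) converges linearly to J_{γC}(z̄), which is the unique x ∈ H with 0 ∈ A x + C x + D_K x; that is, there exist c ≥ 0 and r ∈ [0,1) with ‖z_n − z̄‖ ≤ c·rⁿ and ‖x_n − J_{γC}(z̄)‖ ≤ c·rⁿ for all n. -/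

import Mathlib

open Filter Topology
open scoped RealInnerProductSpace Pointwise

noncomputable section

variable {H G : Type*}

/-- A set-valued operator `A` is `ρ`-monotone. -/
def IsMonotoneSV [NormedAddCommGroup H] [InnerProductSpace ℝ H]
    (ρ : ℝ) (A : H → Set H) : Prop :=
  ∀ x y u v, u ∈ A x → v ∈ A y → ρ * ‖x - y‖ ^ 2 ≤ ⟪x - y, u - v⟫

/-- `A` is maximally `ρ`-monotone: it is `ρ`-monotone and its graph is maximal, under
inclusion, among graphs of `ρ`-monotone operators. -/
def IsMaxMonotoneSV [NormedAddCommGroup H] [InnerProductSpace ℝ H]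
    (ρ : ℝ) (A : H → Set H) : Prop :=
  IsMonotoneSV ρ A ∧
    ∀ A' : H → Set H, IsMonotoneSV ρ A' → (∀ x, A x ⊆ A' x) → ∀ x, A' x = A x

/-- `C` is `β`-cocoercive. -/
def IsCocoercive [NormedAddCommGroup H] [InnerProductSpace ℝ H]
    (β : ℝ) (C : H → H) : Prop :=
  ∀ x y, β * ‖C x - C y‖ ^ 2 ≤ ⟪x - y, C x - C y⟫

/-- `k` is a Lipschitz bound for `f`. -/
def IsLipBound {E F : Type*} [NormedAddCommGroup E] [NormedAddCommGroup F]
    (k : ℝ) (f : E → F) : Prop :=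
  ∀ x y, ‖f x - f y‖ ≤ k * ‖x - y‖

/-- `k` is the (smallest) Lipschitz constant of `f`. -/
def IsLipConst {E F : Type*} [NormedAddCommGroup E] [NormedAddCommGroup F]
    (k : ℝ) (f : E → F) : Prop :=
  IsLipBound k f ∧ ∀ k', IsLipBound k' f → k ≤ k'

/-- A single-valued map `B` is monotone. -/
def IsMonotoneMap [NormedAddCommGroup G] [InnerProductSpace ℝ G]
    (B : G → G) : Prop :=
  ∀ x y, (0:ℝ) ≤ ⟪x - y, B x - B y⟫

/-- The operator `D_M : x ↦ α M (L x - c) + M (B (L x))`. -/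
def Dop [NormedAddCommGroup H] [InnerProductSpace ℝ H]
    [NormedAddCommGroup G] [InnerProductSpace ℝ G]
    (α : ℝ) (L : H →L[ℝ] G) (c : G) (B : G → G) (M : G →L[ℝ] H) : H → H :=
  fun x => α • M (L x - c) + M (B (L x))

/-- `λ_min = inf {⟪x, K (L x)⟫ : ‖x‖ = 1}`. -/
def lambdaMin [NormedAddCommGroup H] [InnerProductSpace ℝ H]
    [NormedAddCommGroup G] [InnerProductSpace ℝ G]
    (L : H →L[ℝ] G) (K : G →L[ℝ] H) : ℝ :=
  sInf {r : ℝ | ∃ x : H, ‖x‖ = 1 ∧ r = ⟪x, K (L x)⟫}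

/-- The step-size bound `χ`. -/
def chiConst (β ρ κ : ℝ) : ℝ :=
  if 0 ≤ ρ then 4 * β / (1 + Real.sqrt (1 + 16 * β ^ 2 * κ ^ 2))
  else min (4 * β / (1 + Real.sqrt (1 + 16 * β ^ 2 * κ ^ 2))) (-1 / ρ)

/-- Basic estimate of the three-operator splitting iteration: the increments satisfy a contraction
inequality with a uniform factor. -/
theorem exists_contraction_factor [NormedAddCommGroup H] [InnerProductSpace ℝ H]
    {m k τ : ℝ} (hm : 0 < m) (hk0 : 0 ≤ k) (hk : k * (1 + m) < 1) (hτ : 0 < τ) :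
    ∃ r : ℝ, 0 ≤ r ∧ r < 1 ∧ ∀ u s q t : H, τ * ‖q‖ ^ 2 ≤ ⟪q, s - u - t⟫ →
      ‖u‖ ^ 2 ≤ 2 * m * ⟪s + q, u⟫ → ‖t‖ ^ 2 ≤ k * ‖s‖ ^ 2 →
      ‖u + q + t‖ ≤ r * ‖u + s + q‖ := by
  obtain ⟨m', hmm', hkm'⟩ : ∃ m', m < m' ∧ k * (1 + m') < 1 := by
    refine ⟨m + (1 - k * (1 + m)) / (2 * (k + 1)), ?_, ?_⟩
    · have : 0 < (1 - k * (1 + m)) / (2 * (k + 1)) := div_pos (by linarith) (by linarith)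
      linarith
    · have h1 : (1 - k * (1 + m)) / (2 * (k + 1)) * (2 * (k + 1)) = 1 - k * (1 + m) :=
        div_mul_cancel₀ _ (by linarith)
      have : 0 < (1 - k * (1 + m)) / (2 * (k + 1)) := div_pos (by linarith) (by linarith)
      nlinarith
  have hm'0 : 0 < m' := hm.trans hmm'
  have hε : 0 < m⁻¹ - m'⁻¹ := sub_pos.2 ((inv_lt_inv₀ hm'0 hm).2 hmm')
  set δ := min (min (m⁻¹ - m'⁻¹) (1 - k * (1 + m'))) (min (2 * τ) 1) with hδ
  have hδ0 : 0 < δ := lt_min (lt_min hε (by linarith)) (lt_min (by linarith) one_pos)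
  have hδ1 : δ ≤ m⁻¹ - m'⁻¹ := (min_le_left _ _).trans (min_le_left _ _)
  have hδ2 : δ ≤ 1 - k * (1 + m') := (min_le_left _ _).trans (min_le_right _ _)
  have hδ3 : δ ≤ 2 * τ := (min_le_right _ _).trans (min_le_left _ _)
  have hδ4 : δ ≤ 1 := (min_le_right _ _).trans (min_le_right _ _)
  refine ⟨√(1 - δ / 3), Real.sqrt_nonneg _, ?_, ?_⟩
  · rw [Real.sqrt_lt' one_pos]; linarith
  intro u s q t h1 h2 h3
  have e1 : ‖u + q + t‖ ^ 2 = ‖u‖ ^ 2 + ‖q‖ ^ 2 + ‖t‖ ^ 2 + 2 * ⟪q, u⟫ + 2 * ⟪u, t⟫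
      + 2 * ⟪q, t⟫ := by
    simp only [← real_inner_self_eq_norm_sq, inner_add_left, inner_add_right,
      real_inner_comm u q, real_inner_comm u t, real_inner_comm q t]
    ring
  have e2 : ‖u + s + q‖ ^ 2 = ‖u‖ ^ 2 + ‖s‖ ^ 2 + ‖q‖ ^ 2 + 2 * ⟪s, u⟫ + 2 * ⟪q, s⟫
      + 2 * ⟪q, u⟫ := by
    simp only [← real_inner_self_eq_norm_sq, inner_add_left, inner_add_right,
      real_inner_comm u s, real_inner_comm u q, real_inner_comm q s]
    ring
  have e3 : ‖u + s + q‖ ^ 2 ≤ 3 * (‖u‖ ^ 2 + ‖s‖ ^ 2 + ‖q‖ ^ 2) := by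
    have h : ‖u + s + q‖ ≤ ‖u‖ + ‖s‖ + ‖q‖ := norm_add₃_le
    have h' := pow_le_pow_left₀ (norm_nonneg _) h 2
    nlinarith [sq_nonneg (‖u‖ - ‖s‖), sq_nonneg (‖s‖ - ‖q‖), sq_nonneg (‖u‖ - ‖q‖)]
  have e4 : 2 * ⟪u, t⟫ ≤ m'⁻¹ * ‖u‖ ^ 2 + m' * ‖t‖ ^ 2 := by
    have h : 0 ≤ ‖u - m' • t‖ ^ 2 := sq_nonneg _
    rw [norm_sub_sq_real, inner_smul_right, norm_smul, mul_pow, Real.norm_eq_abs, sq_abs] at h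
    have h' := mul_nonneg (inv_nonneg.2 hm'0.le) h
    have : m'⁻¹ * (‖u‖ ^ 2 - 2 * (m' * ⟪u, t⟫) + m' ^ 2 * ‖t‖ ^ 2)
        = m'⁻¹ * ‖u‖ ^ 2 - 2 * ⟪u, t⟫ + m' * ‖t‖ ^ 2 := by
      field_simp
    linarith
  have e5 : m⁻¹ * ‖u‖ ^ 2 ≤ 2 * ⟪s + q, u⟫ := by
    rw [inv_mul_le_iff₀ hm]; linarith
  rw [inner_add_left] at e5
  rw [inner_sub_right, inner_sub_right] at h1
  have e6 : (1 + m') * ‖t‖ ^ 2 ≤ k * (1 + m') * ‖s‖ ^ 2 := by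
    have := mul_le_mul_of_nonneg_left h3 (by linarith : 0 ≤ 1 + m')
    linarith
  have g1 := mul_le_mul_of_nonneg_right hδ1 (sq_nonneg ‖u‖)
  have g2 := mul_le_mul_of_nonneg_right hδ2 (sq_nonneg ‖s‖)
  have g3 := mul_le_mul_of_nonneg_right hδ3 (sq_nonneg ‖q‖)
  have e7 : ‖u + q + t‖ ^ 2 ≤ (1 - δ / 3) * ‖u + s + q‖ ^ 2 := by
    have g4 := mul_le_mul_of_nonneg_left e3 hδ0.le
    nlinarith
  calc ‖u + q + t‖ ≤ √((1 - δ / 3) * ‖u + s + q‖ ^ 2) := Real.le_sqrt_of_sq_le e7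
    _ = √(1 - δ / 3) * ‖u + s + q‖ := by
      rw [Real.sqrt_mul (by linarith), Real.sqrt_sq (norm_nonneg _)]

/-- A nonnegative sequence obeying a contractive recursion with geometrically decaying
perturbations decays geometrically. -/
theorem exists_geometric_bound_of_perturbed_contraction {a : ℕ → ℝ} (ha : ∀ n, 0 ≤ a n)
    {r η M N : ℝ} (hr0 : 0 ≤ r) (hr1 : r < 1) (hη0 : 0 ≤ η) (hη1 : η < 1) (hM : 0 ≤ M)
    (h : ∀ n, a (n + 1) ≤ r * a n + η ^ n * (M + N * a n)) :
    ∃ C s : ℝ, 0 ≤ C ∧ 0 ≤ s ∧ s < 1 ∧ ∀ n, a n ≤ C * s ^ n := by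
  obtain ⟨s', hs', hs'1⟩ := exists_between (max_lt hr1 hη1)
  obtain ⟨s, hs's, hs1⟩ := exists_between hs'1
  have hrs : r < s' := (le_max_left _ _).trans_lt hs'
  have hηs : η < s' := (le_max_right _ _).trans_lt hs'
  have hs0 : 0 < s := by linarith
  have hlim : Tendsto (fun n : ℕ => r + N * η ^ n) atTop (𝓝 (r + N * 0)) :=
    ((tendsto_pow_atTop_nhds_zero_of_lt_one hη0 hη1).const_mul N).const_add r
  rw [mul_zero, add_zero] at hlim
  obtain ⟨n₀, hn₀⟩ := eventually_atTop.1 (hlim.eventually (gt_mem_nhds hrs))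
  have hterm : ∀ i, 0 ≤ a i / s ^ i := fun i => div_nonneg (ha i) (pow_nonneg hs0.le i)
  set S := ∑ i ∈ Finset.range (n₀ + 1), a i / s ^ i with hS
  have hS0 : 0 ≤ S := Finset.sum_nonneg fun i _ => hterm i
  have hq0 : 0 ≤ M / (s - s') := div_nonneg hM (by linarith)
  refine ⟨S + M / (s - s'), s, by positivity, hs0.le, hs1, ?_⟩
  have hsmall : ∀ n ≤ n₀, a n ≤ (S + M / (s - s')) * s ^ n := by
    intro n hn
    have h1 : a n / s ^ n ≤ S :=
      Finset.single_le_sum (f := fun i => a i / s ^ i) (fun i _ => hterm i)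
        (Finset.mem_range.2 (by omega))
    rw [← div_le_iff₀ (pow_pos hs0 n)]
    linarith
  intro n
  induction n with
  | zero => exact hsmall 0 (Nat.zero_le _)
  | succ n ih =>
    by_cases hn : n + 1 ≤ n₀
    · exact hsmall _ hn
    have h1 := hn₀ n (by omega)
    have h2 : η ^ n ≤ s ^ n := pow_le_pow_left₀ hη0 (by linarith) n
    have h3 := mul_le_mul_of_nonneg_right h1.le (ha n)
    have h4 := mul_le_mul_of_nonneg_left ih (by linarith : 0 ≤ s')
    have h5 := mul_le_mul_of_nonneg_left h2 hM
    have h6 : M / (s - s') * (s - s') = M := div_mul_cancel₀ _ (by linarith)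
    have h7 : 0 ≤ S * (s - s') * s ^ n :=
      mul_nonneg (mul_nonneg hS0 (by linarith)) (pow_nonneg hs0.le n)
    calc a (n + 1) ≤ r * a n + η ^ n * (M + N * a n) := h n
      _ ≤ s' * ((S + M / (s - s')) * s ^ n) + M * s ^ n := by linarith
      _ = s' * ((S + M / (s - s')) * s ^ n) + M / (s - s') * (s - s') * s ^ n := by rw [h6]
      _ ≤ (S + M / (s - s')) * s ^ (n + 1) := by rw [pow_succ]; linarith

section DopEstimates

variable [NormedAddCommGroup H] [InnerProductSpace ℝ H]
  [NormedAddCommGroup G] [InnerProductSpace ℝ G]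

theorem Dop_eq (α : ℝ) (L : H →L[ℝ] G) (c : G) (B : G → G) (M : G →L[ℝ] H) (x : H) :
    Dop α L c B M x = M (α • (L x - c) + B (L x)) := by
  simp [Dop]

theorem Dop_sub_Dop (α : ℝ) (L : H →L[ℝ] G) (c : G) (B : G → G) (M : G →L[ℝ] H) (x y : H) :
    Dop α L c B M x - Dop α L c B M y = M (α • L x + B (L x)) - M (α • L y + B (L y)) := by
  simp only [Dop, map_sub, map_add, map_smul, smul_sub]
  abel

theorem lambdaMin_mul_norm_sq_le (L : H →L[ℝ] G) (K : G →L[ℝ] H) (x : H) :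
    lambdaMin L K * ‖x‖ ^ 2 ≤ ⟪x, K (L x)⟫ := by
  rcases eq_or_ne x 0 with rfl | hx
  · simp
  have hx' : ‖x‖ ≠ 0 := norm_ne_zero_iff.2 hx
  have hbdd : BddBelow {r : ℝ | ∃ x : H, ‖x‖ = 1 ∧ r = ⟪x, K (L x)⟫} := by
    refine ⟨-‖K.comp L‖, ?_⟩
    rintro r ⟨v, hv, rfl⟩
    have h1 := abs_le.1 (abs_real_inner_le_norm v (K (L v)))
    have h2 := (K.comp L).le_opNorm v
    simp only [hv, one_mul, mul_one, ContinuousLinearMap.comp_apply] at h1 h2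
    linarith [h1.1]
  have h := csInf_le hbdd ⟨‖x‖⁻¹ • x, by rw [norm_smul, norm_inv, norm_norm,
    inv_mul_cancel₀ hx'], rfl⟩
  rw [map_smul, map_smul, inner_smul_left, inner_smul_right] at h
  simp only [conj_trivial] at h
  calc lambdaMin L K * ‖x‖ ^ 2 ≤ (‖x‖⁻¹ * (‖x‖⁻¹ * ⟪x, K (L x)⟫)) * ‖x‖ ^ 2 :=
        mul_le_mul_of_nonneg_right h (sq_nonneg _)
    _ = ⟪x, K (L x)⟫ := by field_simp

theorem Dop_strongly_monotone [CompleteSpace H] [CompleteSpace G]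
    {α ζt : ℝ} {L : H →L[ℝ] G} {K : G →L[ℝ] H} {B : G → G} (c : G)
    (hα : 0 ≤ α) (hB : IsMonotoneMap B)
    (hζt : IsLipBound ζt (fun x : H => (ContinuousLinearMap.adjoint L - K) (B (L x)))) (x y : H) :
    (α * lambdaMin L K - ζt) * ‖x - y‖ ^ 2 ≤
      ⟪x - y, Dop α L c B K x - Dop α L c B K y⟫ := by
  have h1 := mul_le_mul_of_nonneg_left (lambdaMin_mul_norm_sq_le L K (x - y)) hα
  have h2 := hB (L x) (L y)
  have h3 : ⟪x - y, (ContinuousLinearMap.adjoint L - K) (B (L x)) -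
      (ContinuousLinearMap.adjoint L - K) (B (L y))⟫ ≤ ζt * ‖x - y‖ ^ 2 :=
    calc _ ≤ ‖x - y‖ * ‖_‖ := real_inner_le_norm _ _
      _ ≤ ‖x - y‖ * (ζt * ‖x - y‖) := mul_le_mul_of_nonneg_left (hζt x y) (norm_nonneg _)
      _ = _ := by ring
  have e1 : Dop α L c B K x - Dop α L c B K y = α • K (L (x - y)) + (K (B (L x) - B (L y))) := by
    simp only [Dop, map_sub, smul_sub]
    abel
  have e2 : (ContinuousLinearMap.adjoint L - K) (B (L x)) -
      (ContinuousLinearMap.adjoint L - K) (B (L y)) =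
      ContinuousLinearMap.adjoint L (B (L x) - B (L y)) - K (B (L x) - B (L y)) := by
    simp only [sub_apply, map_sub]
    abel
  rw [e2, inner_sub_right, ContinuousLinearMap.adjoint_inner_right, map_sub L] at h3
  rw [e1, inner_add_right, inner_smul_right]
  linarith

theorem norm_Dop_sub_Dop_le {α ζ : ℝ} (hα : 0 ≤ α) (L : H →L[ℝ] G) (c : G) {B : G → G}
    (hζ : 0 ≤ ζ) (hB : IsLipBound ζ B) (M K : G →L[ℝ] H) (x x₀ : H) :
    ‖Dop α L c B M x - Dop α L c B K x‖ ≤ ‖M - K‖ *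
      (‖α • (L x₀ - c) + B (L x₀)‖ + (α + ζ) * ‖L‖ * ‖x - x₀‖) := by
  rw [Dop_eq, Dop_eq, ← sub_apply]
  refine ((M - K).le_opNorm _).trans (mul_le_mul_of_nonneg_left ?_ (norm_nonneg _))
  have e : α • (L x - c) + B (L x) =
      (α • (L x₀ - c) + B (L x₀)) + α • (L (x - x₀)) + (B (L x) - B (L x₀)) := by
    simp only [map_sub, smul_sub]
    abel
  have h1 : ‖α • L (x - x₀)‖ ≤ α * (‖L‖ * ‖x - x₀‖) := by
    rw [norm_smul, Real.norm_of_nonneg hα]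
    exact mul_le_mul_of_nonneg_left (L.le_opNorm _) hα
  have h2 : ‖B (L x) - B (L x₀)‖ ≤ ζ * (‖L‖ * ‖x - x₀‖) := by
    refine (hB _ _).trans (mul_le_mul_of_nonneg_left ?_ hζ)
    rw [← map_sub]
    exact L.le_opNorm _
  rw [e]
  refine norm_add₃_le.trans ?_
  linarith

end DopEstimates

/-- The resolvent of a `ρ`-monotone operator is Lipschitzian. -/
theorem resolvent_lipschitz [NormedAddCommGroup H] [InnerProductSpace ℝ H]
    {ρ γ : ℝ} {A : H → Set H} (hA : IsMonotoneSV ρ A) (hγ : 0 < γ) (hργ : -1 < ρ * γ)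
    {J : H → H} (hJ : ∀ x, γ⁻¹ • (x - J x) ∈ A (J x)) (x y : H) :
    ‖J x - J y‖ ≤ (1 + ρ * γ)⁻¹ * ‖x - y‖ := by
  have h := hA _ _ _ _ (hJ x) (hJ y)
  rw [← smul_sub, inner_smul_right, le_inv_mul_iff₀ hγ,
    show x - J x - (y - J y) = (x - y) - (J x - J y) by abel, inner_sub_right,
    real_inner_self_eq_norm_sq] at h
  have h2 := real_inner_le_norm (J x - J y) (x - y)
  rw [le_inv_mul_iff₀ (by linarith)]
  rcases (norm_nonneg (J x - J y)).eq_or_lt with h0 | h0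
  · rw [← h0, mul_zero]; exact norm_nonneg _
  · refine le_of_mul_le_mul_left ?_ h0
    nlinarith


/-- Method of continuity: if `A` is surjective and the operators `A + t P`, `0 ≤ t ≤ 1`, are
strongly monotone with a common constant, with `P` Lipschitzian, then `A + P` is surjective. -/
theorem exists_sub_mem_of_strongly_monotone_homotopy [NormedAddCommGroup H]
    [InnerProductSpace ℝ H] [CompleteSpace H] {A : H → Set H} {P : H → H} {l μ : ℝ}
    (hl : 0 ≤ l) (hμ : 0 < μ) (hP : IsLipBound l P)
    (hmono : ∀ t : ℝ, 0 ≤ t → t ≤ 1 → ∀ x y u v, u ∈ A x → v ∈ A y →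
      μ * ‖x - y‖ ^ 2 ≤ ⟪x - y, (u - v) + t • (P x - P y)⟫)
    (hsurj : ∀ y, ∃ x, y ∈ A x) (y : H) : ∃ x, y - P x ∈ A x := by
  obtain ⟨N, hN⟩ := exists_nat_gt (l / μ)
  have hN0 : (0 : ℝ) < N := (div_nonneg hl hμ.le).trans_lt hN
  have hstep : ∀ n : ℕ, n ≤ N → ∀ y, ∃ x, y - ((n : ℝ) / N) • P x ∈ A x := by
    intro n
    induction n with
    | zero => intro _ y; simpa using hsurj y
    | succ n ih =>
      intro hn y
      choose f hf using ih (by omega)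
      have hn' : (n : ℝ) + 1 ≤ N := by exact_mod_cast hn
      have ht0 : (0 : ℝ) ≤ (n : ℝ) / N := by positivity
      have ht1 : (n : ℝ) / N ≤ 1 := by rw [div_le_one hN0]; linarith
      have hflip : ∀ a b, ‖f a - f b‖ ≤ μ⁻¹ * ‖a - b‖ := by
        intro a b
        have h := hmono _ ht0 ht1 _ _ _ _ (hf a) (hf b)
        rw [show a - ((n : ℝ) / N) • P (f a) - (b - ((n : ℝ) / N) • P (f b)) +
          ((n : ℝ) / N) • (P (f a) - P (f b)) = a - b by rw [smul_sub]; abel] at h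
        have h2 := real_inner_le_norm (f a - f b) (a - b)
        rw [le_inv_mul_iff₀ hμ]
        rcases (norm_nonneg (f a - f b)).eq_or_lt with h0 | h0
        · rw [← h0, mul_zero]; exact norm_nonneg _
        · refine le_of_mul_le_mul_left ?_ h0
          nlinarith
      have hq : l / μ / N < 1 := by rwa [div_lt_one hN0]
      have hg : ContractingWith (Real.toNNReal (l / μ / N))
          (fun x => f (y - (N : ℝ)⁻¹ • P x)) := by
        refine ⟨by rwa [Real.toNNReal_lt_one], LipschitzWith.of_dist_le_mul fun a b => ?_⟩
        rw [Real.coe_toNNReal _ (by positivity), dist_eq_norm, dist_eq_norm]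
        calc _ ≤ μ⁻¹ * ‖y - (N : ℝ)⁻¹ • P a - (y - (N : ℝ)⁻¹ • P b)‖ := hflip _ _
          _ = μ⁻¹ * ((N : ℝ)⁻¹ * ‖P b - P a‖) := by
            rw [sub_sub_sub_cancel_left, ← smul_sub, norm_smul, Real.norm_of_nonneg (by positivity)]
          _ ≤ μ⁻¹ * ((N : ℝ)⁻¹ * (l * ‖b - a‖)) := by gcongr; exact hP b a
          _ = l / μ / N * ‖a - b‖ := by rw [norm_sub_rev]; field_simp
      have hfix : f (y - (N : ℝ)⁻¹ • P (ContractingWith.fixedPoint _ hg)) =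
          ContractingWith.fixedPoint _ hg := hg.fixedPoint_isFixedPt
      refine ⟨ContractingWith.fixedPoint _ hg, ?_⟩
      have h := hf (y - (N : ℝ)⁻¹ • P (ContractingWith.fixedPoint _ hg))
      rw [hfix] at h
      convert h using 1
      rw [sub_sub, ← add_smul]
      congr 2
      push_cast
      ring
  obtain ⟨x, hx⟩ := hstep N le_rfl y
  refine ⟨x, ?_⟩
  rwa [div_self hN0.ne', one_smul] at hx

/-- A strongly monotone sum of a `ρ`-monotone operator having a resolvent and a Lipschitzian map
has a zero. -/
theorem exists_neg_mem_of_strongly_monotone_add [NormedAddCommGroup H]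
    [InnerProductSpace ℝ H] [CompleteSpace H] {A : H → Set H} {F : H → H} {ρ σ γ l : ℝ}
    (hA : IsMonotoneSV ρ A) (hF : IsLipBound l F) (hl : 0 ≤ l)
    (hFmono : ∀ x y, σ * ‖x - y‖ ^ 2 ≤ ⟪x - y, F x - F y⟫) (hρσ : 0 < ρ + σ)
    (hγ : 0 < γ) (hργ : -1 < ρ * γ) {J : H → H} (hJ : ∀ x, γ⁻¹ • (x - J x) ∈ A (J x)) :
    ∃ x, -F x ∈ A x := by
  have hμ : 0 < γ⁻¹ + ρ := by
    have : γ⁻¹ + ρ = γ⁻¹ * (1 + ρ * γ) := by field_simp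
    rw [this]
    exact mul_pos (inv_pos.2 hγ) (by linarith)
  obtain ⟨x, hx⟩ := exists_sub_mem_of_strongly_monotone_homotopy
    (A := fun x => {u | u - γ⁻¹ • x ∈ A x}) (P := fun x => F x - γ⁻¹ • x)
    (l := l + γ⁻¹) (μ := min (γ⁻¹ + ρ) (ρ + σ)) (by positivity) (lt_min hμ hρσ)
    (by
      intro x y
      have h := hF x y
      calc ‖F x - γ⁻¹ • x - (F y - γ⁻¹ • y)‖ = ‖(F x - F y) - γ⁻¹ • (x - y)‖ := by
            congr 1; rw [smul_sub]; abel
        _ ≤ ‖F x - F y‖ + ‖γ⁻¹ • (x - y)‖ := norm_sub_le _ _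
        _ ≤ (l + γ⁻¹) * ‖x - y‖ := by
            rw [norm_smul, Real.norm_of_nonneg (by positivity)]; linarith)
    (by
      intro t ht0 ht1 x y u v hu hv
      have h1 := hA _ _ _ _ hu hv
      have h2 := mul_le_mul_of_nonneg_left (hFmono x y) ht0
      have e : u - v + t • (F x - γ⁻¹ • x - (F y - γ⁻¹ • y)) =
          (u - γ⁻¹ • x - (v - γ⁻¹ • y)) + t • (F x - F y) + ((1 - t) * γ⁻¹) • (x - y) := by
        module
      rw [e, inner_add_right, inner_add_right, inner_smul_right, inner_smul_right,
        real_inner_self_eq_norm_sq]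
      have h3 : min (γ⁻¹ + ρ) (ρ + σ) ≤ ρ + t * σ + (1 - t) * γ⁻¹ := by
        have := mul_le_mul_of_nonneg_left (min_le_left (γ⁻¹ + ρ) (ρ + σ)) (sub_nonneg.2 ht1)
        have := mul_le_mul_of_nonneg_left (min_le_right (γ⁻¹ + ρ) (ρ + σ)) ht0
        linarith
      have := mul_le_mul_of_nonneg_right h3 (sq_nonneg ‖x - y‖)
      linarith)
    (by
      intro y
      refine ⟨J (γ • y), ?_⟩
      have h := hJ (γ • y)
      rwa [smul_sub, inv_smul_smul₀ hγ.ne'] at h) 0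
  refine ⟨x, ?_⟩
  simpa using hx

theorem statement19 {H G : Type*} [NormedAddCommGroup H] [InnerProductSpace ℝ H] [CompleteSpace H]
    [NormedAddCommGroup G] [InnerProductSpace ℝ G] [CompleteSpace G]
    (ρ β ζ α : ℝ) (A : H → Set H) (C : H → H) (B : G → G)
    (L : H →L[ℝ] G) (K : G →L[ℝ] H) (c : G)
    (hA : IsMaxMonotoneSV ρ A)
    (hβ : 0 < β) (hC : IsCocoercive β C)
    (hζ : 0 < ζ) (hBmono : IsMonotoneMap B) (hBlip : IsLipBound ζ B)
    (hα : 0 ≤ α)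
    (ζt : ℝ)
    (hζt : IsLipConst ζt (fun x : H => (ContinuousLinearMap.adjoint L - K) (B (L x))))
    (κ : ℝ) (hκ : IsLipConst κ (fun x : H => K (α • L x + B (L x))))
    (hρhat : 0 < (ρ + α * lambdaMin L K - ζt))
    (hDK : ∃ x : H, Dop α L c B K x ≠ 0)
    (Kn : ℕ → G →L[ℝ] H) (ω0 etab : ℝ) (hω0 : 0 ≤ ω0)
    (hetab0 : 0 ≤ etab) (hetab1 : etab < 1)
    (hKn : ∀ n, ‖Kn n - K‖ ≤ ω0 * etab ^ n)
    (γ : ℝ) (hγ0 : 0 < γ)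
    (hΓ₁ : κ ^ 2 * γ ^ 2 * (1 + γ / (2 * β)) < 1) (hΓ₂ : ρ * γ > -1)
    (J JC : H → H) (hJ : ∀ x y : H, J x = y ↔ x - y ∈ γ • A y)
    (hJC : ∀ x y : H, JC x = y ↔ x = y + γ • C y)
    (R V : H → H)
    (hRdef : ∀ z, R z = J ((2:ℝ) • JC z - z - γ • Dop α L c B K (JC z)))
    (hVdef : ∀ z, V z = R z - γ • Dop α L c B K (R z) + z -
      (JC z - γ • Dop α L c B K (JC z)))
    (z x w y : ℕ → H)
    (hx : ∀ n, x n = JC (z n))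
    (hw : ∀ n, w n = Dop α L c B (Kn n) (x n))
    (hy : ∀ n, y n = J ((2:ℝ) • x n - z n - γ • w n))
    (hzrec : ∀ n, z (n + 1) =
      z n + y n - x n - γ • (Dop α L c B (Kn n) (y n) - w n)) :
    ∃ zb : H, V zb = zb ∧
      ((0:H) ∈ (fun u => u + C (JC zb) + Dop α L c B K (JC zb)) '' A (JC zb)) ∧
      (∀ x' : H, ((0:H) ∈ (fun u => u + C x' + Dop α L c B K x') '' A x') → x' = JC zb) ∧
      ∃ cc r : ℝ, 0 ≤ cc ∧ 0 ≤ r ∧ r < 1 ∧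
        ∀ n, ‖z n - zb‖ ≤ cc * r ^ n ∧ ‖x n - JC zb‖ ≤ cc * r ^ n := by
  have hlip : ∀ a b, ‖Dop α L c B K a - Dop α L c B K b‖ ≤ κ * ‖a - b‖ := fun a b => by
    rw [Dop_sub_Dop]; exact hκ.1 a b
  have hκ0 : 0 ≤ κ := by
    obtain ⟨v, hv⟩ := hDK
    have hv' : 0 < ‖Dop α L c B K v - 0‖ := by rw [sub_zero]; exact norm_pos_iff.2 hv
    have := (norm_nonneg _).trans (hκ.1 (Dop α L c B K v) 0)
    exact nonneg_of_mul_nonneg_left this hv'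
  have hmono := Dop_strongly_monotone c hα hBmono hζt.1
  have hJA : ∀ a, γ⁻¹ • (a - J a) ∈ A (J a) := fun a =>
    (Set.mem_smul_set_iff_inv_smul_mem₀ hγ0.ne' _ _).1 ((hJ a _).1 rfl)
  have hJClip : ∀ a b, ‖JC a - JC b‖ ≤ ‖a - b‖ := by
    intro a b
    have h1 := (hJC a _).1 rfl
    have h2 := (hJC b _).1 rfl
    have h3 := hC (JC a) (JC b)
    have h4 : 0 ≤ ⟪JC a - JC b, C (JC a) - C (JC b)⟫ := le_trans (by positivity) h3
    have e : a - b = (JC a - JC b) + γ • (C (JC a) - C (JC b)) := by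
      nth_rewrite 1 [h1, h2]; rw [smul_sub]; abel
    have h5 : ‖JC a - JC b‖ ^ 2 ≤ ⟪JC a - JC b, a - b⟫ := by
      rw [e, inner_add_right, inner_smul_right, real_inner_self_eq_norm_sq]
      linarith [mul_nonneg hγ0.le h4]
    have h6 := real_inner_le_norm (JC a - JC b) (a - b)
    rcases (norm_nonneg (JC a - JC b)).eq_or_lt with h0 | h0
    · rw [← h0]; exact norm_nonneg _
    · exact le_of_mul_le_mul_left (by linarith [sq ‖JC a - JC b‖]) h0
  obtain ⟨r, hr0, hr1, hr⟩ := exists_contraction_factor (H := H) (m := γ / (2 * β))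
    (k := κ ^ 2 * γ ^ 2) (by positivity) (by positivity) hΓ₁ (mul_pos hγ0 hρhat)
  have hClip : ∀ a b, ‖C a - C b‖ ≤ β⁻¹ * ‖a - b‖ := by
    intro a b
    have h := hC a b
    have h2 := real_inner_le_norm (a - b) (C a - C b)
    rw [le_inv_mul_iff₀ hβ]
    rcases (norm_nonneg (C a - C b)).eq_or_lt with h0 | h0
    · rw [← h0, mul_zero]; exact norm_nonneg _
    · refine le_of_mul_le_mul_left ?_ h0
      nlinarith
  have hFmono : ∀ a b, (α * lambdaMin L K - ζt) * ‖a - b‖ ^ 2 ≤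
      ⟪a - b, (C a + Dop α L c B K a) - (C b + Dop α L c B K b)⟫ := by
    intro a b
    have h1 : 0 ≤ ⟪a - b, C a - C b⟫ := le_trans (by positivity) (hC a b)
    have h2 := hmono a b
    rw [add_sub_add_comm, inner_add_right]
    linarith
  obtain ⟨xb, hxb⟩ := exists_neg_mem_of_strongly_monotone_add
    (F := fun a => C a + Dop α L c B K a) (l := β⁻¹ + κ) hA.1
    (by
      intro a b
      rw [add_sub_add_comm]
      refine (norm_add_le _ _).trans ?_
      linarith [hClip a b, hlip a b])
    (by positivity) hFmono (by linarith) hγ0 hΓ₂ hJA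
  obtain ⟨zb, hzb⟩ : ∃ zb, zb = xb + γ • C xb := ⟨_, rfl⟩
  have hJzb : JC zb = xb := (hJC _ _).2 hzb
  have hRzb : R zb = xb := by
    rw [hRdef, hJzb, hJ, Set.mem_smul_set_iff_inv_smul_mem₀ hγ0.ne']
    convert hxb using 1
    rw [inv_smul_eq_iff₀ hγ0.ne', hzb]
    module
  have hVzb : V zb = zb := by rw [hVdef, hRzb, hJzb]; abel
  refine ⟨zb, hVzb, ?_, ?_, ?_⟩
  · rw [hJzb]
    refine ⟨_, hxb, ?_⟩
    beta_reduce
    abel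
  · rintro x' ⟨u, hu, hu0⟩
    rw [hJzb]
    have h1 := hA.1 _ _ _ _ hu hxb
    have h2 := hFmono x' xb
    have e : u - -(C xb + Dop α L c B K xb) =
        -((C x' + Dop α L c B K x') - (C xb + Dop α L c B K xb)) := by
      have : u = -(C x' + Dop α L c B K x') := by
        rw [eq_neg_iff_add_eq_zero, ← add_assoc]; exact hu0
      rw [this]; abel
    rw [e, inner_neg_right] at h1
    have h3 : ‖x' - xb‖ ^ 2 ≤ 0 := by nlinarith
    exact sub_eq_zero.1 (norm_eq_zero.1 (pow_eq_zero_iff two_ne_zero |>.1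
      (le_antisymm h3 (sq_nonneg _))))
  have hV : ∀ a, ‖V a - zb‖ ≤ r * ‖a - zb‖ := by
    intro a
    have hc1 := (hJC a _).1 rfl
    have hca : a - JC a = γ • C (JC a) := by nth_rewrite 1 [hc1]; abel
    have hcb : zb - xb = γ • C xb := by rw [hzb]; abel
    have hu : (a - JC a) - (zb - xb) = γ • (C (JC a) - C xb) := by
      rw [hca, hcb, smul_sub]
    have := hr ((a - JC a) - (zb - xb)) (JC a - R a) (R a - xb)
      (γ • (Dop α L c B K (JC a) - Dop α L c B K (R a))) ?_ ?_ ?_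
    · convert this using 2
      · rw [hVdef]; simp only [smul_sub]; abel
      · congr 1; abel
    · have h1 := hA.1 _ _ _ _ (hJA ((2:ℝ) • JC a - a - γ • Dop α L c B K (JC a))) hxb
      rw [← hRdef] at h1
      have h2 := hmono (R a) xb
      have h3 := mul_le_mul_of_nonneg_left (add_le_add h1 h2) hγ0.le
      rw [← inner_add_right, ← inner_smul_right (𝕜 := ℝ)] at h3
      have e : γ • (γ⁻¹ • ((2:ℝ) • JC a - a - γ • Dop α L c B K (JC a) - R a) -
          -(C xb + Dop α L c B K xb) + (Dop α L c B K (R a) - Dop α L c B K xb)) =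
          JC a - R a - ((a - JC a) - (zb - xb)) -
            γ • (Dop α L c B K (JC a) - Dop α L c B K (R a)) := by
        rw [hcb, smul_add, smul_sub, smul_inv_smul₀ hγ0.ne']
        module
      rw [e] at h3
      linarith
    · rw [show JC a - R a + (R a - xb) = JC a - xb by abel, hu, inner_smul_right, norm_smul,
        mul_pow, Real.norm_of_nonneg hγ0.le]
      have h3 := hC (JC a) xb
      calc γ ^ 2 * ‖C (JC a) - C xb‖ ^ 2
          = γ ^ 2 / β * (β * ‖C (JC a) - C xb‖ ^ 2) := by field_simp
        _ ≤ γ ^ 2 / β * ⟪JC a - xb, C (JC a) - C xb⟫ :=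
          mul_le_mul_of_nonneg_left h3 (by positivity)
        _ = _ := by field_simp
    · have h4 := pow_le_pow_left₀ (norm_nonneg _) (hlip (JC a) (R a)) 2
      rw [norm_smul, mul_pow, Real.norm_of_nonneg hγ0.le]
      calc γ ^ 2 * ‖Dop α L c B K (JC a) - Dop α L c B K (R a)‖ ^ 2
          ≤ γ ^ 2 * (κ * ‖JC a - R a‖) ^ 2 := mul_le_mul_of_nonneg_left h4 (sq_nonneg _)
        _ = _ := by ring
  have hJlip := resolvent_lipschitz hA.1 hγ0 hΓ₂ hJA
  obtain ⟨l, hl⟩ : ∃ l, l = (1 + ρ * γ)⁻¹ := ⟨_, rfl⟩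
  have hl0 : 0 ≤ l := by rw [hl]; exact inv_nonneg.2 (by linarith)
  rw [← hl] at hJlip
  have hxle : ∀ n, ‖x n - xb‖ ≤ ‖z n - zb‖ := fun n => by
    rw [hx, ← hJzb]; exact hJClip _ _
  obtain ⟨e₀, he₀⟩ : ∃ e₀, e₀ = ‖α • (L xb - c) + B (L xb)‖ := ⟨_, rfl⟩
  have he₀0 : 0 ≤ e₀ := by rw [he₀]; exact norm_nonneg _
  obtain ⟨e₁, he₁⟩ : ∃ e₁, e₁ = (α + ζ) * ‖L‖ := ⟨_, rfl⟩
  have he₁0 : 0 ≤ e₁ := by rw [he₁]; positivity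
  have hpert : ∀ n a, ‖Dop α L c B (Kn n) a - Dop α L c B K a‖ ≤
      ω0 * etab ^ n * (e₀ + e₁ * ‖a - xb‖) := by
    intro n a
    rw [he₀, he₁]
    refine (norm_Dop_sub_Dop_le hα L c hζ.le hBlip (Kn n) K a xb).trans
      (mul_le_mul_of_nonneg_right (hKn n) (by positivity))
  have hRle : ∀ a, ‖R a - xb‖ ≤ l * (3 + γ * κ) * ‖a - zb‖ := by
    intro a
    have h1 := hJlip ((2:ℝ) • JC a - a - γ • Dop α L c B K (JC a))
      ((2:ℝ) • JC zb - zb - γ • Dop α L c B K (JC zb))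
    rw [← hRdef, ← hRdef, hRzb] at h1
    refine h1.trans ?_
    rw [mul_assoc]
    refine mul_le_mul_of_nonneg_left ?_ hl0
    have h2 := hJClip a zb
    have h3 := mul_le_mul_of_nonneg_left
      ((hlip (JC a) (JC zb)).trans (mul_le_mul_of_nonneg_left h2 hκ0)) hγ0.le
    have e : (2:ℝ) • JC a - a - γ • Dop α L c B K (JC a) -
        ((2:ℝ) • JC zb - zb - γ • Dop α L c B K (JC zb)) =
        (2:ℝ) • (JC a - JC zb) - (a - zb) -
          γ • (Dop α L c B K (JC a) - Dop α L c B K (JC zb)) := by module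
    rw [e]
    refine (norm_sub_le _ _).trans ?_
    refine (add_le_add_left (norm_sub_le _ _) _).trans ?_
    rw [norm_smul, norm_smul, Real.norm_of_nonneg hγ0.le, Real.norm_of_nonneg zero_le_two]
    linarith
  obtain ⟨l₁, hl₁⟩ : ∃ l₁, l₁ = l * (3 + γ * κ) := ⟨_, rfl⟩
  rw [← hl₁] at hRle
  obtain ⟨cc, s, hcc, hs0, hs1, hbound⟩ := exists_geometric_bound_of_perturbed_contraction
    (a := fun n => ‖z n - zb‖) (fun n => norm_nonneg _)
    (M := ω0 * (((1 + γ * κ) * (l * γ) + γ) * e₀ + γ * (e₀ + e₁ * (l * γ * (ω0 * e₀)))))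
    (N := ω0 * (((1 + γ * κ) * (l * γ) + γ) * e₁ + γ * (e₁ * (l * γ * (ω0 * e₁) + l₁))))
    hr0 hr1 hetab0 hetab1 (by positivity) (by
      intro n
      obtain ⟨d, hd⟩ : ∃ d, d = ‖z n - zb‖ := ⟨_, rfl⟩
      have hd0 : 0 ≤ d := by rw [hd]; exact norm_nonneg _
      have hω1 : etab ^ n ≤ 1 := pow_le_one₀ hetab0 hetab1.le
      have hωn0 : 0 ≤ etab ^ n := pow_nonneg hetab0 n
      have hwn : ‖w n - Dop α L c B K (x n)‖ ≤ ω0 * etab ^ n * (e₀ + e₁ * d) := by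
        rw [hw]
        refine (hpert n (x n)).trans (mul_le_mul_of_nonneg_left ?_ (by positivity))
        have := mul_le_mul_of_nonneg_left (hxle n) he₁0
        rw [hd]; linarith
      have hyR : ‖y n - R (z n)‖ ≤ l * γ * (ω0 * etab ^ n * (e₀ + e₁ * d)) := by
        rw [hy, hRdef, ← hx]
        refine (hJlip _ _).trans ?_
        rw [sub_sub_sub_cancel_left, ← smul_sub, norm_smul, Real.norm_of_nonneg hγ0.le,
          norm_sub_rev, mul_assoc]
        gcongr
      have hyR' : ‖y n - R (z n)‖ ≤ l * γ * (ω0 * (e₀ + e₁ * d)) := by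
        refine hyR.trans ?_
        refine mul_le_mul_of_nonneg_left (mul_le_mul_of_nonneg_right ?_ ?_) ?_
        · exact mul_le_of_le_one_right hω0 hω1
        · positivity
        · positivity
      have hyxb : ‖y n - xb‖ ≤ l * γ * (ω0 * (e₀ + e₁ * d)) + l₁ * d := by
        have h1 := norm_sub_le_norm_sub_add_norm_sub (y n) (R (z n)) xb
        have h2 := hRle (z n)
        rw [← hd] at h2
        linarith
      have hDy : ‖Dop α L c B (Kn n) (y n) - Dop α L c B K (y n)‖ ≤
          ω0 * etab ^ n * (e₀ + e₁ * (l * γ * (ω0 * (e₀ + e₁ * d)) + l₁ * d)) := by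
        refine (hpert n (y n)).trans ?_
        gcongr
      have hDR := hlip (y n) (R (z n))
      have e : z (n + 1) - zb = (V (z n) - zb) + (y n - R (z n)) +
          γ • (w n - Dop α L c B K (x n)) -
          γ • (Dop α L c B (Kn n) (y n) - Dop α L c B K (y n)) -
          γ • (Dop α L c B K (y n) - Dop α L c B K (R (z n))) := by
        rw [hzrec, hVdef, ← hx]; module
      have hsum : ‖z (n + 1) - zb‖ ≤ ‖V (z n) - zb‖ + ‖y n - R (z n)‖ +
          γ * ‖w n - Dop α L c B K (x n)‖ +
          γ * ‖Dop α L c B (Kn n) (y n) - Dop α L c B K (y n)‖ +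
          γ * ‖Dop α L c B K (y n) - Dop α L c B K (R (z n))‖ := by
        have hs : ∀ v : H, ‖γ • v‖ = γ * ‖v‖ := fun v => by
          rw [norm_smul, Real.norm_of_nonneg hγ0.le]
        rw [e, ← hs, ← hs, ← hs]
        refine (norm_sub_le _ _).trans (add_le_add_left ?_ _)
        refine (norm_sub_le _ _).trans (add_le_add_left ?_ _)
        exact norm_add₃_le
      have hVn := hV (z n)
      have g1 := mul_le_mul_of_nonneg_left hwn hγ0.le
      have g2 := mul_le_mul_of_nonneg_left hDy hγ0.le
      have g3 := mul_le_mul_of_nonneg_left (hDR.trans (mul_le_mul_of_nonneg_left hyR hκ0)) hγ0.le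
      rw [← hd] at hVn ⊢
      linarith)
  refine ⟨cc, s, hcc, hs0, hs1, fun n => ⟨hbound n, ?_⟩⟩
  rw [hJzb]
  exact (hxle n).trans (hbound n)
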